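/- Fix 0 < α < 1 and τ₂ > τ₁ > 0. Let f : ℝⁿ → ℝ be smooth, bounded, and everywhere positive. Then for every x ∈ ℝⁿ one has L_α(f^{τ₁})(x) ≥ (τ₁/τ₂) · f(x)^{τ₁−τ₂} · L_α(f^{τ₂})(x), where L_α g(x) = −∫_{ℝⁿ} (g(x+y)+g(x−y)−2g(x))/|y|^{n+2α} dy (both integrals converge absolutely). -/

import Mathlib

open MeasureTheory Metric Set Filter

/-- Up to a positive constant, the fractional Laplacian of order `α` written via second
differences: `L_α g (x) = -∫ (g(x+y)+g(x-y)-2g(x))/|y|^{n+2α} dy`. -/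
noncomputable def fracLap (n : ℕ) (α : ℝ) (g : EuclideanSpace ℝ (Fin n) → ℝ)
    (x : EuclideanSpace ℝ (Fin n)) : ℝ :=
  -∫ y : EuclideanSpace ℝ (Fin n),
      (g (x + y) + g (x - y) - 2 * g x) / ‖y‖ ^ ((n : ℝ) + 2 * α)

theorem rpow_sub_rpow_le_div_mul {a b s t : ℝ} (ha : 0 < a) (hb : 0 < b) (hs : 0 < s)
    (hst : s < t) : b ^ s - a ^ s ≤ s / t * a ^ (s - t) * (b ^ t - a ^ t) := by
  have ht : 0 < t := hs.trans hst
  have hp : 1 ≤ t / s := (one_le_div hs).2 hst.le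
  have hr : 0 < b / a := div_pos hb ha
  have key := one_add_mul_self_le_rpow_one_add (s := (b / a) ^ s - 1)
    (by linarith [Real.rpow_pos_of_pos hr s]) hp
  rw [add_sub_cancel, ← Real.rpow_mul hr.le, mul_div_cancel₀ _ hs.ne',
    Real.div_rpow hb.le ha.le, Real.div_rpow hb.le ha.le] at key
  have has := Real.rpow_pos_of_pos ha s
  have hat := Real.rpow_pos_of_pos ha t
  rw [Real.rpow_sub ha]
  have h := mul_le_mul_of_nonneg_left key (by positivity : 0 ≤ s / t * a ^ s)
  have e₁ : s / t * a ^ s * (1 + t / s * (b ^ s / a ^ s - 1)) =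
      s / t * a ^ s + (b ^ s - a ^ s) := by field_simp
  have e₂ : s / t * a ^ s * (b ^ t / a ^ t) =
      s / t * (a ^ s / a ^ t) * (b ^ t - a ^ t) + s / t * a ^ s := by field_simp; ring
  linarith

theorem exists_norm_second_difference_le_of_norm_le_one {E : Type*} [NormedAddCommGroup E]
    [NormedSpace ℝ E] [ProperSpace E] {g : E → ℝ} (hg : ContDiff ℝ 2 g) (x : E) :
    ∃ C, ∀ y, ‖y‖ ≤ 1 → ‖g (x + y) + g (x - y) - 2 * g x‖ ≤ C * ‖y‖ ^ 2 := by
  have hdg : ContDiff ℝ 1 (fderiv ℝ g) := hg.fderiv_right (by norm_num)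
  obtain ⟨K, hK⟩ := (isCompact_closedBall x 1).exists_bound_of_continuousOn
    (hdg.continuous_fderiv (by norm_num)).continuousOn
  refine ⟨K * 2, fun y hy => ?_⟩
  have hgd (z : E) : HasFDerivAt g (fderiv ℝ g z) z :=
    (hg.differentiable (by norm_num) z).hasFDerivAt
  have hderiv (z : E) : HasFDerivAt (fun z => g (x + z) + g (x - z) - 2 * g x)
      (fderiv ℝ g (x + z) - fderiv ℝ g (x - z)) z := by
    have h₁ := (hgd (x + z)).comp z ((hasFDerivAt_id z).const_add x)
    have h₂ := (hgd (x - z)).comp z ((hasFDerivAt_id z).const_sub x)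
    refine ((h₁.add h₂).sub_const (2 * g x)).congr_fderiv ?_
    ext v
    simp [sub_eq_add_neg]
  have hbound (z : E) (hz : z ∈ closedBall (0 : E) ‖y‖) :
      ‖fderiv ℝ g (x + z) - fderiv ℝ g (x - z)‖ ≤ K * 2 * ‖y‖ := by
    have hz' : ‖z‖ ≤ ‖y‖ := by simpa using hz
    have hK0 : 0 ≤ K := (norm_nonneg _).trans (hK x (by simp))
    have h := (convex_closedBall x 1).norm_image_sub_le_of_norm_fderiv_le
      (fun w _ => hdg.differentiable (by norm_num) w) hK
      (x := x - z) (y := x + z) (by simpa using hz'.trans hy) (by simpa using hz'.trans hy)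
    have e : x + z - (x - z) = (2 : ℝ) • z := by rw [two_smul]; abel
    rw [e, norm_smul, Real.norm_ofNat] at h
    nlinarith
  have h := (convex_closedBall (0 : E) ‖y‖).norm_image_sub_le_of_norm_hasFDerivWithin_le
    (fun z _ => (hderiv z).hasFDerivWithinAt) hbound (x := 0) (y := y) (by simp) (by simp)
  have e : g (x + 0) + g (x - 0) - 2 * g x = 0 := by simp; ring
  rw [e, sub_zero, sub_zero] at h
  linarith

theorem integrable_min_sq_one_div_norm_rpow (n : ℕ) {α : ℝ} (hα : α ∈ Ioo (0 : ℝ) 1) :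
    Integrable (fun y : EuclideanSpace ℝ (Fin n) =>
      min (‖y‖ ^ 2) 1 / ‖y‖ ^ ((n : ℝ) + 2 * α)) := by
  obtain ⟨h0, h1⟩ := hα
  rcases Nat.eq_zero_or_pos n with rfl | hn
  · exact Integrable.of_finite
  have : Nonempty (Fin n) := ⟨⟨0, hn⟩⟩
  refine (integrable_fun_norm_addHaar volume
    (f := fun r : ℝ => min (r ^ 2) 1 / r ^ ((n : ℝ) + 2 * α))).2 ?_
  have hpow {r : ℝ} (hr : 0 < r) : r ^ (n - 1) = r ^ ((n : ℝ) - 1) := by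
    rw [← Real.rpow_natCast, Nat.cast_sub hn, Nat.cast_one]
  rw [finrank_euclideanSpace_fin, ← Ioc_union_Ioi_eq_Ioi zero_le_one]
  refine IntegrableOn.union ?_ ?_
  · have h : IntegrableOn (fun r : ℝ => r ^ (1 - 2 * α)) (Ioc 0 1) :=
      (intervalIntegrable_iff_integrableOn_Ioc_of_le zero_le_one).1
        (intervalIntegral.intervalIntegrable_rpow' (by linarith))
    refine h.congr_fun (fun r hr => ?_) measurableSet_Ioc
    have hr2 : min (r ^ 2) 1 = r ^ (2 : ℝ) := by
      rw [Real.rpow_two, min_eq_left (pow_le_one₀ hr.1.le hr.2)]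
    simp only [smul_eq_mul]
    rw [hr2, hpow hr.1, ← Real.rpow_sub hr.1, ← Real.rpow_add hr.1]
    ring_nf
  · have h : IntegrableOn (fun r : ℝ => r ^ (-1 - 2 * α)) (Ioi 1) :=
      integrableOn_Ioi_rpow_of_lt (by linarith) one_pos
    refine h.congr_fun (fun r hr => ?_) measurableSet_Ioi
    have hr0 : 0 < r := one_pos.trans hr
    simp only [smul_eq_mul]
    rw [min_eq_right (one_le_pow₀ (le_of_lt hr)), hpow hr0, mul_one_div, ← Real.rpow_sub hr0]
    ring_nf

theorem integrable_second_difference_div_norm_rpow {n : ℕ} {α : ℝ} (hα : α ∈ Ioo (0 : ℝ) 1)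
    {g : EuclideanSpace ℝ (Fin n) → ℝ} (hg : ContDiff ℝ 2 g) {M : ℝ} (hM : ∀ x, ‖g x‖ ≤ M)
    (x : EuclideanSpace ℝ (Fin n)) :
    Integrable (fun y : EuclideanSpace ℝ (Fin n) =>
      (g (x + y) + g (x - y) - 2 * g x) / ‖y‖ ^ ((n : ℝ) + 2 * α)) := by
  obtain ⟨C, hC⟩ := exists_norm_second_difference_le_of_norm_le_one hg x
  have hcont := hg.continuous
  refine ((integrable_min_sq_one_div_norm_rpow n hα).const_mul (max C (4 * M))).mono' ?_
    (.of_forall fun y => ?_)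
  · exact (Measurable.div (by fun_prop) (by fun_prop)).aestronglyMeasurable
  · have hp : 0 ≤ ‖y‖ ^ ((n : ℝ) + 2 * α) := Real.rpow_nonneg (norm_nonneg y) _
    rw [norm_div, Real.norm_of_nonneg hp, ← mul_div_assoc]
    gcongr
    rcases le_total ‖y‖ 1 with hy | hy
    · rw [min_eq_left (pow_le_one₀ (norm_nonneg y) hy)]
      exact (hC y hy).trans (by gcongr; exact le_max_left _ _)
    · rw [min_eq_right (one_le_pow₀ hy), mul_one]
      refine le_trans ?_ (le_max_right _ _)
      have h₁ := abs_le.1 (hM (x + y))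
      have h₂ := abs_le.1 (hM (x - y))
      have h₃ := abs_le.1 (hM x)
      exact abs_le.2 ⟨by linarith, by linarith⟩

/-- For a smooth, bounded, everywhere positive `f` and `τ₂ > τ₁ > 0`, at every point the
second-difference integrals for `f^{τ₁}` and `f^{τ₂}` converge absolutely and
`L_α(f^{τ₁})(x) ≥ (τ₁/τ₂) f(x)^{τ₁-τ₂} L_α(f^{τ₂})(x)`. -/
theorem stmt_17 (n : ℕ) (α : ℝ) (hα : α ∈ Set.Ioo (0 : ℝ) 1)
    (τ₁ τ₂ : ℝ) (hτ₁ : 0 < τ₁) (hτ : τ₁ < τ₂)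
    (f : EuclideanSpace ℝ (Fin n) → ℝ) (hf : ContDiff ℝ (⊤ : ℕ∞) f)
    (hfbdd : ∃ M : ℝ, ∀ x, f x ≤ M) (hfpos : ∀ x, 0 < f x) :
    ∀ x : EuclideanSpace ℝ (Fin n),
      Integrable (fun y : EuclideanSpace ℝ (Fin n) =>
        (f (x + y) ^ τ₁ + f (x - y) ^ τ₁ - 2 * f x ^ τ₁) / ‖y‖ ^ ((n : ℝ) + 2 * α)) volume ∧
      Integrable (fun y : EuclideanSpace ℝ (Fin n) =>
        (f (x + y) ^ τ₂ + f (x - y) ^ τ₂ - 2 * f x ^ τ₂) / ‖y‖ ^ ((n : ℝ) + 2 * α)) volume ∧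
      τ₁ / τ₂ * f x ^ (τ₁ - τ₂) * fracLap n α (fun y => f y ^ τ₂) x ≤
        fracLap n α (fun y => f y ^ τ₁) x := by
  obtain ⟨M, hM⟩ := hfbdd
  have hint (τ : ℝ) (h : 0 < τ) (x : EuclideanSpace ℝ (Fin n)) :=
    integrable_second_difference_div_norm_rpow hα (g := fun y => f y ^ τ) (M := M ^ τ)
      ((contDiff_infty.1 hf 2).rpow_const_of_ne fun y => (hfpos y).ne')
      (fun y => by
        rw [Real.norm_of_nonneg (Real.rpow_nonneg (hfpos y).le τ)]
        exact Real.rpow_le_rpow (hfpos y).le (hM y) h.le) x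
  intro x
  have hint₁ := hint τ₁ hτ₁ x
  have hint₂ := hint τ₂ (hτ₁.trans hτ) x
  refine ⟨hint₁, hint₂, ?_⟩
  unfold fracLap
  rw [mul_neg, neg_le_neg_iff, ← integral_const_mul]
  refine integral_mono hint₁ (hint₂.const_mul _) fun y => ?_
  dsimp only
  rw [← mul_div_assoc]
  gcongr
  have h₁ := rpow_sub_rpow_le_div_mul (hfpos x) (hfpos (x + y)) hτ₁ hτ
  have h₂ := rpow_sub_rpow_le_div_mul (hfpos x) (hfpos (x - y)) hτ₁ hτ
  linarith
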